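/- Under the scaled ABS recursions carried out with nonzero denominators through all m steps, the m×m matrix L with entries L_{jk} = v_jᵀ A p_k (1 ≤ j,k ≤ m) is lower triangular with nonzero diagonal entries; in particular L is nonsingular. -/

import Mathlib

open Matrix

/-- A rank-one ABS update sends a vector `y` to `H y` minus a multiple of `H c`. -/
theorem abs_update_mulVec {n : ℕ} (H : Matrix (Fin n) (Fin n) ℝ) (c w y : Fin n → ℝ) :
    (H - (w ⬝ᵥ (H *ᵥ c))⁻¹ • vecMulVec (H *ᵥ c) (w ᵥ* H)) *ᵥ y =
      H *ᵥ y - ((w ⬝ᵥ (H *ᵥ c))⁻¹ * (w ⬝ᵥ (H *ᵥ y))) • (H *ᵥ c) := by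
  rw [sub_mulVec, smul_mulVec, vecMulVec_mulVec, ← dotProduct_mulVec, op_smul_eq_smul, smul_smul]

/-- The ABS matrix `H k` annihilates all the vectors used in the preceding updates. -/
theorem abs_mulVec_eq_zero {m n : ℕ} (H : ℕ → Matrix (Fin n) (Fin n) ℝ) (c w : ℕ → Fin n → ℝ)
    (hd : ∀ k < m, w k ⬝ᵥ (H k *ᵥ c k) ≠ 0)
    (hH : ∀ k < m, H (k + 1) =
      H k - (w k ⬝ᵥ (H k *ᵥ c k))⁻¹ • vecMulVec (H k *ᵥ c k) (w k ᵥ* H k))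
    {j k : ℕ} (hjk : j < k) (hk : k ≤ m) : H k *ᵥ c j = 0 := by
  induction k with
  | zero => omega
  | succ k ih =>
    rw [hH k (by omega), abs_update_mulVec]
    rcases Nat.lt_succ_iff_lt_or_eq.mp hjk with h | rfl
    · simp [ih h (by omega)]
    · rw [inv_mul_cancel₀ (hd j (by omega)), one_smul, sub_self]

/-- Under the scaled ABS recursions carried out with nonzero
denominators through all `m` steps, the `m×m` matrix `L` with entries
`L_{jk} = v_jᵀ A p_k` is lower triangular with nonzero diagonal entries;
in particular `L` is nonsingular. -/
theorem abs_implicit_factorization_lower_triangular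
    {m n : ℕ} (hmn : m ≤ n)
    (A : Matrix (Fin m) (Fin n) ℝ) (b : Fin m → ℝ)
    (H : ℕ → Matrix (Fin n) (Fin n) ℝ) (x : ℕ → Fin n → ℝ)
    (v : ℕ → Fin m → ℝ) (z w : ℕ → Fin n → ℝ)
    (p : ℕ → Fin n → ℝ) (α : ℕ → ℝ)
    (hH1 : (H 0).det ≠ 0)
    (hp : ∀ k < m, p k = (H k)ᵀ *ᵥ z k)
    (hα : ∀ k < m, α k = (v k ⬝ᵥ (A *ᵥ x k - b)) / (v k ⬝ᵥ (A *ᵥ p k)))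
    (hx : ∀ k < m, x (k + 1) = x k - α k • p k)
    (hd1 : ∀ k < m, v k ⬝ᵥ (A *ᵥ ((H k)ᵀ *ᵥ z k)) ≠ 0)
    (hd2 : ∀ k < m, w k ⬝ᵥ (H k *ᵥ (Aᵀ *ᵥ v k)) ≠ 0)
    (hH : ∀ k < m, H (k + 1) =
      H k - (w k ⬝ᵥ (H k *ᵥ (Aᵀ *ᵥ v k)))⁻¹ •
        vecMulVec (H k *ᵥ (Aᵀ *ᵥ v k)) (w k ᵥ* H k))
    (L : Matrix (Fin m) (Fin m) ℝ)
    (hL : ∀ j k : Fin m, L j k = v j.1 ⬝ᵥ (A *ᵥ p k.1)) :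
    (∀ j k : Fin m, j < k → L j k = 0) ∧ (∀ j : Fin m, L j j ≠ 0) ∧ L.det ≠ 0 := by
  have lower : ∀ j k : Fin m, j < k → L j k = 0 := fun j k hjk => by
    have hzero := abs_mulVec_eq_zero H (fun i => Aᵀ *ᵥ v i) w hd2 hH hjk k.2.le
    rw [hL, hp k k.2, dotProduct_mulVec, ← mulVec_transpose, dotProduct_mulVec,
      vecMul_transpose, hzero, zero_dotProduct]
  have diag : ∀ j : Fin m, L j j ≠ 0 := fun j => by
    rw [hL, hp j j.2]
    exact hd1 j j.2
  refine ⟨lower, diag, ?_⟩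
  rw [det_of_isLowerTriangular L lower]
  exact Finset.prod_ne_zero_iff.mpr fun j _ => diag j
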